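/- (Gradient dominance.) For every K ∈ 𝕂, writing Ψ_i = R_i + B_iᵀ E_i(P^K) B_i, the following chain of inequalities holds: C(K) − C(K*) ≤ ‖𝐗^{K*}‖_max · ∑_{i=1}^N tr((L^K_i)ᵀ Ψ_i^{−1} L^K_i) ≤ (‖𝐗^{K*}‖_max / Λ_min(R)) · ‖L^K‖₂² ≤ (‖𝐗^{K*}‖_max / (4 μ² Λ_min(R))) · ‖∇C(K)‖₂². -/

import Mathlib

open Matrix Filter
open scoped Kronecker Topology

namespace MJLS

noncomputable section

attribute [local instance] Classical.propDecidable

/-- Closed-loop matrices `Γ i = A i - B i * K i`. -/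
def Gam {d k N : ℕ} (A : Fin N → Matrix (Fin d) (Fin d) ℝ)
    (B : Fin N → Matrix (Fin d) (Fin k) ℝ)
    (K : Fin N → Matrix (Fin k) (Fin d) ℝ) : Fin N → Matrix (Fin d) (Fin d) ℝ :=
  fun i => A i - B i * K i

/-- The operator `E_i(V) = ∑ j, p i j • V j`. -/
def opE {d N : ℕ} (Pr : Matrix (Fin N) (Fin N) ℝ)
    (V : Fin N → Matrix (Fin d) (Fin d) ℝ) : Fin N → Matrix (Fin d) (Fin d) ℝ :=
  fun i => ∑ j, Pr i j • V j

/-- The matrix `𝒜 = diag(Γᵀ ⊗ Γᵀ) (P ⊗ I)`. -/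
def calA {d N : ℕ} (Pr : Matrix (Fin N) (Fin N) ℝ)
    (Γ : Fin N → Matrix (Fin d) (Fin d) ℝ) :
    Matrix (Fin N × Fin d × Fin d) (Fin N × Fin d × Fin d) ℝ :=
  (Matrix.reindex (Equiv.prodComm (Fin d × Fin d) (Fin N))
      (Equiv.prodComm (Fin d × Fin d) (Fin N))
      (Matrix.blockDiagonal fun i => (Γ i)ᵀ ⊗ₖ (Γ i)ᵀ)) *
    (Pr ⊗ₖ (1 : Matrix (Fin d × Fin d) (Fin d × Fin d) ℝ))

/-- `K` is mean-square stabilizing: the spectral radius of `𝒜` is less than `1`. -/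
def MSS {d k N : ℕ} (Pr : Matrix (Fin N) (Fin N) ℝ)
    (A : Fin N → Matrix (Fin d) (Fin d) ℝ) (B : Fin N → Matrix (Fin d) (Fin k) ℝ)
    (K : Fin N → Matrix (Fin k) (Fin d) ℝ) : Prop :=
  spectralRadius ℂ ((calA Pr (Gam A B K)).map (algebraMap ℝ ℂ)) < 1

/-- `P` solves the coupled Lyapunov equations for the policy `K`. -/
def IsLyap {d k N : ℕ} (Pr : Matrix (Fin N) (Fin N) ℝ)
    (A : Fin N → Matrix (Fin d) (Fin d) ℝ) (B : Fin N → Matrix (Fin d) (Fin k) ℝ)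
    (Q : Fin N → Matrix (Fin d) (Fin d) ℝ) (R : Fin N → Matrix (Fin k) (Fin k) ℝ)
    (K : Fin N → Matrix (Fin k) (Fin d) ℝ)
    (P : Fin N → Matrix (Fin d) (Fin d) ℝ) : Prop :=
  ∀ i, P i = Q i + (K i)ᵀ * R i * K i + (Gam A B K i)ᵀ * opE Pr P i * Gam A B K i

/-- `P^K`, the (for mean-square stabilizing `K`, unique) solution of the coupled
Lyapunov equations. -/
def PK {d k N : ℕ} (Pr : Matrix (Fin N) (Fin N) ℝ)
    (A : Fin N → Matrix (Fin d) (Fin d) ℝ) (B : Fin N → Matrix (Fin d) (Fin k) ℝ)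
    (Q : Fin N → Matrix (Fin d) (Fin d) ℝ) (R : Fin N → Matrix (Fin k) (Fin k) ℝ)
    (K : Fin N → Matrix (Fin k) (Fin d) ℝ) : Fin N → Matrix (Fin d) (Fin d) ℝ :=
  if h : ∃ P, IsLyap Pr A B Q R K P then h.choose else 0

/-- The LQR cost `C(K) = ∑ i, π i * tr(P^K_i Sg)`. -/
def cost {d k N : ℕ} (Pr : Matrix (Fin N) (Fin N) ℝ)
    (A : Fin N → Matrix (Fin d) (Fin d) ℝ) (B : Fin N → Matrix (Fin d) (Fin k) ℝ)
    (Q : Fin N → Matrix (Fin d) (Fin d) ℝ) (R : Fin N → Matrix (Fin k) (Fin k) ℝ)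
    (piv : Fin N → ℝ) (Sg : Matrix (Fin d) (Fin d) ℝ)
    (K : Fin N → Matrix (Fin k) (Fin d) ℝ) : ℝ :=
  ∑ i, piv i * (PK Pr A B Q R K i * Sg).trace

/-- The operator `T_j(V) = ∑ i, p i j • (Γ i * V i * Γ iᵀ)`. -/
def opT {d N : ℕ} (Pr : Matrix (Fin N) (Fin N) ℝ)
    (Γ : Fin N → Matrix (Fin d) (Fin d) ℝ)
    (V : Fin N → Matrix (Fin d) (Fin d) ℝ) : Fin N → Matrix (Fin d) (Fin d) ℝ :=
  fun j => ∑ i, Pr i j • (Γ i * V i * (Γ i)ᵀ)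

/-- `𝐗^K = ∑_{t=0}^∞ T^t(X(0))` with `X_i(0) = π i • Sg`. -/
def XK {d N : ℕ} (Pr : Matrix (Fin N) (Fin N) ℝ) (piv : Fin N → ℝ)
    (Sg : Matrix (Fin d) (Fin d) ℝ) (Γ : Fin N → Matrix (Fin d) (Fin d) ℝ) :
    Fin N → Matrix (Fin d) (Fin d) ℝ :=
  ∑' t : ℕ, (opT Pr Γ)^[t] (fun i => piv i • Sg)

/-- `L^K_i = (R i + B iᵀ E_i(P^K) B i) K i - B iᵀ E_i(P^K) A i`. -/
def LK {d k N : ℕ} (Pr : Matrix (Fin N) (Fin N) ℝ)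
    (A : Fin N → Matrix (Fin d) (Fin d) ℝ) (B : Fin N → Matrix (Fin d) (Fin k) ℝ)
    (Q : Fin N → Matrix (Fin d) (Fin d) ℝ) (R : Fin N → Matrix (Fin k) (Fin k) ℝ)
    (K : Fin N → Matrix (Fin k) (Fin d) ℝ) : Fin N → Matrix (Fin k) (Fin d) ℝ :=
  fun i => (R i + (B i)ᵀ * opE Pr (PK Pr A B Q R K) i * B i) * K i
    - (B i)ᵀ * opE Pr (PK Pr A B Q R K) i * A i

/-- The operator `L_i(V) = Γ iᵀ E_i(V) Γ i`. -/
def opL {d N : ℕ} (Pr : Matrix (Fin N) (Fin N) ℝ)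
    (Γ : Fin N → Matrix (Fin d) (Fin d) ℝ)
    (V : Fin N → Matrix (Fin d) (Fin d) ℝ) : Fin N → Matrix (Fin d) (Fin d) ℝ :=
  fun i => (Γ i)ᵀ * opE Pr V i * Γ i

/-- `(P^K)'[E] = ∑_{t=0}^∞ L^t(Eᵀ L^K + (L^K)ᵀ E)`. -/
def PKd {d k N : ℕ} (Pr : Matrix (Fin N) (Fin N) ℝ)
    (Γ : Fin N → Matrix (Fin d) (Fin d) ℝ)
    (Lk E : Fin N → Matrix (Fin k) (Fin d) ℝ) : Fin N → Matrix (Fin d) (Fin d) ℝ :=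
  ∑' t : ℕ, (opL Pr Γ)^[t] (fun i => (E i)ᵀ * Lk i + (Lk i)ᵀ * E i)

/-- `‖V‖₂² = ∑ i, tr(V iᵀ V i)`. -/
def norm2sq {a b N : ℕ} (V : Fin N → Matrix (Fin a) (Fin b) ℝ) : ℝ :=
  ∑ i, ((V i)ᵀ * V i).trace

/-- The inner product `⟨V, S⟩ = ∑ i, tr(V iᵀ S i)`. -/
def ip {a b N : ℕ} (V S : Fin N → Matrix (Fin a) (Fin b) ℝ) : ℝ :=
  ∑ i, ((V i)ᵀ * S i).trace

/-- The spectral norm (maximal singular value) of a matrix. -/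
def specNorm {a b : ℕ} (M : Matrix (Fin a) (Fin b) ℝ) : ℝ :=
  ⨆ x : {x : EuclideanSpace ℝ (Fin b) // ‖x‖ ≤ 1}, ‖Matrix.toEuclideanLin M x.1‖

/-- The minimal singular value of a square matrix. -/
def sigmaMin {a : ℕ} (M : Matrix (Fin a) (Fin a) ℝ) : ℝ :=
  ⨅ x : {x : EuclideanSpace ℝ (Fin a) // ‖x‖ = 1}, ‖Matrix.toEuclideanLin M x.1‖

/-- `‖V‖_max = max_i ‖V i‖` (spectral norms). -/
def maxNorm {a b N : ℕ} (V : Fin N → Matrix (Fin a) (Fin b) ℝ) : ℝ :=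
  ⨆ i, specNorm (V i)

/-- `Λ_min(V) = min_i σ_min(V i)`. -/
def lamMin {a N : ℕ} (V : Fin N → Matrix (Fin a) (Fin a) ℝ) : ℝ :=
  ⨅ i, sigmaMin (V i)

/-- `μ = (min_i π i) · σ_min(Sg)`. -/
def mu {d N : ℕ} (piv : Fin N → ℝ) (Sg : Matrix (Fin d) (Fin d) ℝ) : ℝ :=
  (⨅ i, piv i) * sigmaMin Sg

/-- `ξ(α) = (1/Λ_min(Q))·((1 + ‖B‖²_max)·α/μ + ‖R‖_max) − 1`. -/
def xi {d k N : ℕ} (B : Fin N → Matrix (Fin d) (Fin k) ℝ)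
    (R : Fin N → Matrix (Fin k) (Fin k) ℝ) (Q : Fin N → Matrix (Fin d) (Fin d) ℝ)
    (piv : Fin N → ℝ) (Sg : Matrix (Fin d) (Fin d) ℝ) (α : ℝ) : ℝ :=
  (1 / lamMin Q) * ((1 + maxNorm B ^ 2) * α / mu piv Sg + maxNorm R) - 1

/-- The smoothness constant
`L(α) = 2·(‖R‖_max + ‖B‖²_max·(1 + 2ξ(α)/‖B‖_max)·α/μ)·α/Λ_min(Q)`. -/
def Lsm {d k N : ℕ} (B : Fin N → Matrix (Fin d) (Fin k) ℝ)
    (R : Fin N → Matrix (Fin k) (Fin k) ℝ) (Q : Fin N → Matrix (Fin d) (Fin d) ℝ)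
    (piv : Fin N → ℝ) (Sg : Matrix (Fin d) (Fin d) ℝ) (α : ℝ) : ℝ :=
  2 * (maxNorm R + maxNorm B ^ 2 * (1 + 2 * xi B R Q piv Sg α / maxNorm B)
      * α / mu piv Sg) * α / lamMin Q

end


/-! ### Helper lemmas -/

/-- Vectorization of a tuple of matrices. -/
def hvec {d N : ℕ} (V : Fin N → Matrix (Fin d) (Fin d) ℝ) : Fin N × Fin d × Fin d → ℝ :=
  fun p => V p.1 p.2.1 p.2.2

theorem calA_apply {d N : ℕ} (Pr : Matrix (Fin N) (Fin N) ℝ)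
    (Γ : Fin N → Matrix (Fin d) (Fin d) ℝ) (i j : Fin N) (a b c e : Fin d) :
    calA Pr Γ (i, a, b) (j, c, e) = Pr i j * Γ i c a * Γ i e b := by
  unfold calA
  rw [Matrix.mul_apply, Finset.sum_eq_single (i, c, e)]
  · simp [Matrix.blockDiagonal_apply, Matrix.kroneckerMap_apply]
    ring
  · rintro ⟨i', c', e'⟩ - hne
    simp only [Matrix.reindex_apply, Matrix.submatrix_apply, Equiv.prodComm_symm,
      Equiv.prodComm_apply, Prod.swap_prod_mk, Matrix.blockDiagonal_apply,
      Matrix.kroneckerMap_apply, Matrix.one_apply]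
    by_cases h1 : i = i'
    · have h2 : (c', e') ≠ (c, e) := by
        rintro h
        apply hne
        rw [← h1, h]
      rw [if_neg h2]; simp
    · rw [if_neg h1]; simp
  · simp

theorem calA_mulVec {d N : ℕ} (Pr : Matrix (Fin N) (Fin N) ℝ)
    (Γ V : Fin N → Matrix (Fin d) (Fin d) ℝ) :
    calA Pr Γ *ᵥ hvec V = hvec (opL Pr Γ V) := by
  ext ⟨i, a, b⟩
  simp only [Matrix.mulVec, dotProduct, Fintype.sum_prod_type, calA_apply, hvec, opL, opE,
    Matrix.mul_apply, Matrix.transpose_apply, Matrix.sum_apply, Matrix.smul_apply, smul_eq_mul,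
    Finset.mul_sum, Finset.sum_mul]
  conv_rhs => rw [Finset.sum_comm]
  refine Finset.sum_congr rfl fun c _ => ?_
  rw [Finset.sum_comm]
  refine Finset.sum_congr rfl fun e _ => ?_
  refine Finset.sum_congr rfl fun j _ => ?_
  ring

theorem calA_transpose_mulVec {d N : ℕ} (Pr : Matrix (Fin N) (Fin N) ℝ)
    (Γ V : Fin N → Matrix (Fin d) (Fin d) ℝ) :
    (calA Pr Γ)ᵀ *ᵥ hvec V = hvec (opT Pr Γ V) := by
  ext ⟨i, a, b⟩
  simp only [Matrix.mulVec, dotProduct, Fintype.sum_prod_type, Matrix.transpose_apply, calA_apply,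
    hvec, opT,
    Matrix.mul_apply, Matrix.transpose_apply, Matrix.sum_apply, Matrix.smul_apply, smul_eq_mul,
    Finset.mul_sum, Finset.sum_mul]
  refine Finset.sum_congr rfl fun c _ => ?_
  rw [Finset.sum_comm]
  refine Finset.sum_congr rfl fun e _ => ?_
  refine Finset.sum_congr rfl fun j _ => ?_
  ring

section
attribute [local instance] Matrix.linftyOpNormedRing Matrix.linftyOpNormedAlgebra

theorem summable_pow_of_spectralRadius {A : Type*} [NormedRing A] [NormedAlgebra ℂ A]
    [CompleteSpace A] (a : A) (h : spectralRadius ℂ a < 1) :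
    Summable fun n : ℕ => ‖a ^ n‖ := by
  obtain ⟨r, hr1, hr2⟩ := ENNReal.lt_iff_exists_nnreal_btwn.1 h
  have hr3 : r < 1 := by exact_mod_cast hr2
  have ht := spectrum.pow_nnnorm_pow_one_div_tendsto_nhds_spectralRadius a
  have hev : ∀ᶠ n : ℕ in atTop, ‖‖a ^ n‖‖ ≤ (r : ℝ) ^ n := by
    filter_upwards [ht.eventually_lt_const hr1, eventually_gt_atTop 0] with n hn hn0
    have h1 : ((‖a ^ n‖₊ : ENNReal) ^ (1 / n : ℝ)) ^ (n : ℝ) ≤ (r : ENNReal) ^ (n : ℝ) :=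
      ENNReal.rpow_le_rpow hn.le (by positivity)
    rw [← ENNReal.rpow_mul, one_div_mul_cancel (by positivity), ENNReal.rpow_one,
      ENNReal.rpow_natCast] at h1
    have h2 : ‖a ^ n‖₊ ≤ r ^ n := by exact_mod_cast h1
    rw [norm_norm]
    exact_mod_cast h2
  exact Summable.of_norm_bounded_eventually_nat
    (summable_geometric_of_lt_one r.2 (by exact_mod_cast hr3)) hev

theorem summable_entry {ι : Type*} [Fintype ι] [DecidableEq ι] (M : Matrix ι ι ℝ)
    (h : spectralRadius ℂ (M.map (algebraMap ℝ ℂ)) < 1) (i j : ι) :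
    Summable fun n : ℕ => (M ^ n) i j := by
  have h1 := summable_pow_of_spectralRadius (M.map (algebraMap ℝ ℂ)) h
  refine Summable.of_norm_bounded h1 fun n => ?_
  have h2 : M.map (algebraMap ℝ ℂ) ^ n = (M ^ n).map (algebraMap ℝ ℂ) :=
    (map_pow ((algebraMap ℝ ℂ).mapMatrix) M n).symm
  rw [h2]
  have h3 : ‖(M ^ n) i j‖ = ‖((M ^ n).map (algebraMap ℝ ℂ)) i j‖ := by simp
  rw [h3]
  generalize (M ^ n).map (algebraMap ℝ ℂ) = W
  rw [Matrix.linfty_opNorm_def]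
  have h4 : ‖W i j‖₊ ≤ ∑ j, ‖W i j‖₊ :=
    Finset.single_le_sum (f := fun j => ‖W i j‖₊) (fun _ _ => zero_le) (Finset.mem_univ j)
  have h5 : ∑ j, ‖W i j‖₊ ≤ Finset.univ.sup fun i => ∑ j, ‖W i j‖₊ :=
    Finset.le_sup (f := fun i => ∑ j, ‖W i j‖₊) (Finset.mem_univ i)
  exact_mod_cast h4.trans h5

end

theorem summable_mulVec {ι : Type*} [Fintype ι] [DecidableEq ι] (M : Matrix ι ι ℝ)
    (h : ∀ i j, Summable fun n : ℕ => (M ^ n) i j) (v : ι → ℝ) (i : ι) :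
    Summable fun n : ℕ => (M ^ n *ᵥ v) i := by
  simp only [Matrix.mulVec, dotProduct]
  exact summable_sum fun j _ => (h i j).mul_right _

theorem hvec_iterate {d N : ℕ} (M : Matrix (Fin N × Fin d × Fin d) (Fin N × Fin d × Fin d) ℝ)
    (F : (Fin N → Matrix (Fin d) (Fin d) ℝ) → (Fin N → Matrix (Fin d) (Fin d) ℝ))
    (hF : ∀ V, M *ᵥ hvec V = hvec (F V)) (V : Fin N → Matrix (Fin d) (Fin d) ℝ) (n : ℕ) :
    hvec (F^[n] V) = M ^ n *ᵥ hvec V := by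
  induction n with
  | zero => simp
  | succ n ih => rw [Function.iterate_succ_apply', ← hF, ih, pow_succ', Matrix.mulVec_mulVec]

theorem summable_iterate {d N : ℕ}
    (M : Matrix (Fin N × Fin d × Fin d) (Fin N × Fin d × Fin d) ℝ)
    (h : ∀ i j, Summable fun n : ℕ => (M ^ n) i j)
    (F : (Fin N → Matrix (Fin d) (Fin d) ℝ) → (Fin N → Matrix (Fin d) (Fin d) ℝ))
    (hF : ∀ V, M *ᵥ hvec V = hvec (F V)) (V : Fin N → Matrix (Fin d) (Fin d) ℝ) :
    Summable fun n : ℕ => F^[n] V := by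
  refine Pi.summable.2 fun i => Pi.summable.2 fun a => Pi.summable.2 fun b => ?_
  have := summable_mulVec M h (hvec V) (i, a, b)
  simp only [← hvec_iterate M F hF] at this
  exact this

theorem opL_summable {d k N : ℕ} {Pr : Matrix (Fin N) (Fin N) ℝ}
    {A : Fin N → Matrix (Fin d) (Fin d) ℝ} {B : Fin N → Matrix (Fin d) (Fin k) ℝ}
    {K : Fin N → Matrix (Fin k) (Fin d) ℝ} (hK : MSS Pr A B K)
    (V : Fin N → Matrix (Fin d) (Fin d) ℝ) :
    Summable fun n : ℕ => (opL Pr (Gam A B K))^[n] V :=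
  summable_iterate (calA Pr (Gam A B K)) (summable_entry _ (by unfold MSS at hK; convert hK)) _
    (calA_mulVec _ _) V

theorem opT_summable {d k N : ℕ} {Pr : Matrix (Fin N) (Fin N) ℝ}
    {A : Fin N → Matrix (Fin d) (Fin d) ℝ} {B : Fin N → Matrix (Fin d) (Fin k) ℝ}
    {K : Fin N → Matrix (Fin k) (Fin d) ℝ} (hK : MSS Pr A B K)
    (V : Fin N → Matrix (Fin d) (Fin d) ℝ) :
    Summable fun n : ℕ => (opT Pr (Gam A B K))^[n] V := by
  refine summable_iterate (calA Pr (Gam A B K))ᵀ (fun i j => ?_) _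
    (calA_transpose_mulVec _ _) V
  simp only [← Matrix.transpose_pow, Matrix.transpose_apply]
  exact summable_entry _ (by unfold MSS at hK; convert hK) _ _

theorem det_ne_zero_of_MSS {d k N : ℕ} {Pr : Matrix (Fin N) (Fin N) ℝ}
    {A : Fin N → Matrix (Fin d) (Fin d) ℝ} {B : Fin N → Matrix (Fin d) (Fin k) ℝ}
    {K : Fin N → Matrix (Fin k) (Fin d) ℝ} (hK : MSS Pr A B K) :
    (1 - calA Pr (Gam A B K)).det ≠ 0 := by
  intro h0
  obtain ⟨v, hv0, hv⟩ := Matrix.exists_mulVec_eq_zero_iff.2 h0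
  rw [Matrix.sub_mulVec, Matrix.one_mulVec, sub_eq_zero] at hv
  apply hv0
  ext i
  have hs := summable_mulVec _ (summable_entry _ (by unfold MSS at hK; convert hK)) v i
  have hc : ∀ n : ℕ, calA Pr (Gam A B K) ^ n *ᵥ v = v := by
    intro n
    induction n with
    | zero => simp
    | succ n ih => rw [pow_succ, ← Matrix.mulVec_mulVec, ← hv, ih]
  simp only [hc] at hs
  simpa using hs.tendsto_atTop_zero

/-- The sum of the Neumann series solves the fixed point equation. -/
theorem tsum_iterate_eq {E : Type*} [AddCommGroup E] [TopologicalSpace E] [IsTopologicalAddGroup E]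
    [T2Space E]
    (F : E → E) (hFa : ∀ x y, F (x + y) = F x + F y) (hFc : Continuous F) (x : E)
    (hs : Summable fun n : ℕ => F^[n] x) :
    ∑' n : ℕ, F^[n] x = x + F (∑' n : ℕ, F^[n] x) := by
  have h1 := hs.tsum_eq_zero_add
  have h2 := hs.hasSum.map (AddMonoidHom.mk' F hFa) hFc
  have h3 : ∑' n : ℕ, F^[n + 1] x = F (∑' n : ℕ, F^[n] x) := by
    refine Eq.trans ?_ h2.tsum_eq
    refine tsum_congr fun n => ?_
    rw [Function.iterate_succ_apply']; rfl
  rw [h3] at h1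
  simpa using h1

theorem psd_of_hasSum {d : ℕ} {f : ℕ → Matrix (Fin d) (Fin d) ℝ} {a : Matrix (Fin d) (Fin d) ℝ}
    (h : HasSum f a) (hf : ∀ n, (f n).PosSemidef) : a.PosSemidef := by
  refine Matrix.PosSemidef.of_dotProduct_mulVec_nonneg ?_ fun x => ?_
  · have h1 := h.matrix_conjTranspose
    have h2 : (fun n => (f n)ᴴ) = f := funext fun n => (hf n).1
    rw [h2] at h1
    exact h1.unique h
  · have hc : Continuous fun M : Matrix (Fin d) (Fin d) ℝ => star x ⬝ᵥ (M *ᵥ x) := by fun_prop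
    refine ge_of_tendsto ((hc.tendsto a).comp h.tendsto_sum_nat) (Eventually.of_forall fun n => ?_)
    exact (Matrix.posSemidef_sum _ fun i _ => hf i).dotProduct_mulVec_nonneg x

theorem psd_conj {a b : ℕ} {M : Matrix (Fin a) (Fin a) ℝ} (h : M.PosSemidef)
    (C : Matrix (Fin a) (Fin b) ℝ) : (Cᵀ * M * C).PosSemidef := by
  simpa using h.conjTranspose_mul_mul_same C

theorem psd_conj' {a b : ℕ} {M : Matrix (Fin a) (Fin a) ℝ} (h : M.PosSemidef)
    (C : Matrix (Fin b) (Fin a) ℝ) : (C * M * Cᵀ).PosSemidef := by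
  simpa using h.mul_mul_conjTranspose_same C

section
open scoped MatrixOrder
theorem psd_factor {d : ℕ} {Y : Matrix (Fin d) (Fin d) ℝ} (hY : Y.PosSemidef) :
    ∃ C : Matrix (Fin d) (Fin d) ℝ, Y = Cᵀ * C := by
  obtain ⟨C, h⟩ := CStarAlgebra.nonneg_iff_eq_star_mul_self.mp hY.nonneg
  exact ⟨C, by simpa [Matrix.star_eq_conjTranspose] using h⟩
end

theorem trace_mul_psd_nonneg {d : ℕ} {Y Z : Matrix (Fin d) (Fin d) ℝ} (hY : Y.PosSemidef)
    (hZ : Z.PosSemidef) : 0 ≤ (Y * Z).trace := by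
  obtain ⟨C, rfl⟩ := psd_factor hY
  rw [Matrix.mul_assoc, Matrix.trace_mul_comm]
  exact (psd_conj' hZ C).trace_nonneg

theorem trace_gram_nonneg {a b : ℕ} (Y : Matrix (Fin a) (Fin b) ℝ) : 0 ≤ (Yᵀ * Y).trace := by
  have := (Matrix.posSemidef_conjTranspose_mul_self Y).trace_nonneg
  simpa using this

theorem quad_eq_inner {a : ℕ} (M : Matrix (Fin a) (Fin a) ℝ) (x : EuclideanSpace ℝ (Fin a)) :
    star x.ofLp ⬝ᵥ (M *ᵥ x.ofLp) = inner ℝ x (WithLp.toLp 2 (M *ᵥ x.ofLp)) := by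
  rw [EuclideanSpace.inner_eq_star_dotProduct, dotProduct_comm]

theorem norm_sq_eq_dot {a : ℕ} (x : EuclideanSpace ℝ (Fin a)) :
    star x.ofLp ⬝ᵥ x.ofLp = ‖x‖ ^ 2 := by
  rw [← real_inner_self_eq_norm_sq, EuclideanSpace.inner_eq_star_dotProduct, dotProduct_comm]

theorem sigmaMin_spec {a : ℕ} (ha : 0 < a) {M : Matrix (Fin a) (Fin a) ℝ} (hM : M.PosDef) :
    0 < sigmaMin M ∧ (M - sigmaMin M • (1 : Matrix (Fin a) (Fin a) ℝ)).PosSemidef := by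
  have : Nonempty (Fin a) := ⟨⟨0, ha⟩⟩
  obtain ⟨i0, hi0⟩ := Finite.exists_min hM.1.eigenvalues
  set lam := hM.1.eigenvalues i0 with hlam
  have hpos : 0 < lam := hM.eigenvalues_pos i0
  have hpsd : (M - lam • (1 : Matrix (Fin a) (Fin a) ℝ)).PosSemidef := by
    have h1 : M - lam • (1 : Matrix (Fin a) (Fin a) ℝ) =
        Unitary.conjStarAlgAut ℝ _ hM.1.eigenvectorUnitary
          (diagonal (hM.1.eigenvalues) - lam • (1 : Matrix (Fin a) (Fin a) ℝ)) := by
      conv_lhs => rw [hM.1.spectral_theorem]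
      rw [map_sub, map_smul, map_one]
      rfl
    rw [h1, Unitary.conjStarAlgAut_apply]
    refine Matrix.PosSemidef.mul_mul_conjTranspose_same ?_ _
    have h2 : diagonal (hM.1.eigenvalues) - lam • (1 : Matrix (Fin a) (Fin a) ℝ)
        = diagonal fun i => hM.1.eigenvalues i - lam := by
      rw [Matrix.smul_one_eq_diagonal, Matrix.diagonal_sub]
    rw [h2, Matrix.posSemidef_diagonal_iff]
    exact fun i => sub_nonneg.2 (hi0 i)
  have hle : sigmaMin M ≤ lam := by
    unfold sigmaMin
    refine (ciInf_le ⟨0, by rintro _ ⟨x, rfl⟩; exact norm_nonneg _⟩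
      (⟨hM.1.eigenvectorBasis i0, hM.1.eigenvectorBasis.orthonormal.1 i0⟩ :
        {x : EuclideanSpace ℝ (Fin a) // ‖x‖ = 1})).trans ?_
    rw [Matrix.toLpLin_apply, hM.1.mulVec_eigenvectorBasis, WithLp.toLp_smul, norm_smul]
    simp [hM.1.eigenvectorBasis.orthonormal.1 i0, abs_of_pos hpos, ← hlam]
  have hge : lam ≤ sigmaMin M := by
    unfold sigmaMin
    have : Nonempty {x : EuclideanSpace ℝ (Fin a) // ‖x‖ = 1} :=
      ⟨⟨hM.1.eigenvectorBasis i0, hM.1.eigenvectorBasis.orthonormal.1 i0⟩⟩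
    refine le_ciInf fun x => ?_
    rw [Matrix.toLpLin_apply]
    have h1 := hpsd.dotProduct_mulVec_nonneg x.1.ofLp
    rw [Matrix.sub_mulVec, Matrix.smul_mulVec, Matrix.one_mulVec, dotProduct_sub,
      dotProduct_smul, quad_eq_inner, norm_sq_eq_dot, x.2] at h1
    have h2 := real_inner_le_norm x.1 (WithLp.toLp 2 (M *ᵥ x.1.ofLp))
    rw [x.2] at h2
    simp only [smul_eq_mul] at h1
    linarith
  have : sigmaMin M = lam := le_antisymm hle hge
  rw [this]
  exact ⟨hpos, hpsd⟩

theorem psd_smul_one {a : ℕ} {c : ℝ} (hc : 0 ≤ c) :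
    (c • (1 : Matrix (Fin a) (Fin a) ℝ)).PosSemidef := Matrix.PosSemidef.one.smul hc

theorem lamMin_spec {a N : ℕ} (ha : 0 < a) (hN : 0 < N) {R : Fin N → Matrix (Fin a) (Fin a) ℝ}
    (hR : ∀ i, (R i).PosDef) :
    0 < lamMin R ∧ ∀ i, (R i - lamMin R • (1 : Matrix (Fin a) (Fin a) ℝ)).PosSemidef := by
  have : Nonempty (Fin N) := ⟨⟨0, hN⟩⟩
  have hb : BddBelow (Set.range fun i => sigmaMin (R i)) := (Set.finite_range _).bddBelow
  constructor
  · obtain ⟨i, hi⟩ := exists_eq_ciInf_of_finite (f := fun i => sigmaMin (R i))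
    unfold lamMin
    rw [← hi]
    exact (sigmaMin_spec ha (hR i)).1
  · intro i
    have h1 : lamMin R ≤ sigmaMin (R i) := ciInf_le hb i
    have h2 := (sigmaMin_spec ha (hR i)).2.add (psd_smul_one (a := a) (sub_nonneg.2 h1))
    rw [sub_smul] at h2
    simpa using h2

theorem mu_spec {d N : ℕ} (hd : 0 < d) (hN : 0 < N) {piv : Fin N → ℝ} (hpiv : ∀ i, 0 < piv i)
    {Sg : Matrix (Fin d) (Fin d) ℝ} (hSg : Sg.PosDef) :
    0 < mu piv Sg ∧
      ∀ i, (piv i • Sg - mu piv Sg • (1 : Matrix (Fin d) (Fin d) ℝ)).PosSemidef := by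
  have : Nonempty (Fin N) := ⟨⟨0, hN⟩⟩
  have hb : BddBelow (Set.range piv) := (Set.finite_range _).bddBelow
  obtain ⟨hs, hps⟩ := sigmaMin_spec hd hSg
  constructor
  · obtain ⟨i, hi⟩ := exists_eq_ciInf_of_finite (f := piv)
    unfold mu
    rw [← hi]
    exact mul_pos (hpiv i) hs
  · intro i
    have h1 : mu piv Sg ≤ piv i * sigmaMin Sg :=
      mul_le_mul_of_nonneg_right (ciInf_le hb i) hs.le
    have h2 := (hps.smul (hpiv i).le).add (psd_smul_one (a := d) (sub_nonneg.2 h1))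
    rw [sub_smul, smul_sub, smul_smul] at h2
    simpa using h2

theorem maxNorm_spec {d N : ℕ} {X : Fin N → Matrix (Fin d) (Fin d) ℝ}
    (hX : ∀ i, (X i).PosSemidef) (i : Fin N) :
    (maxNorm X • (1 : Matrix (Fin d) (Fin d) ℝ) - X i).PosSemidef := by
  have h1 : specNorm (X i) ≤ maxNorm X :=
    le_ciSup (f := fun i => specNorm (X i)) (Set.finite_range _).bddAbove i
  have hb : BddAbove (Set.range fun x : {x : EuclideanSpace ℝ (Fin d) // ‖x‖ ≤ 1} =>
      ‖WithLp.toLp 2 (X i *ᵥ x.1.ofLp)‖) := by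
    refine ⟨‖LinearMap.toContinuousLinearMap (Matrix.toEuclideanLin (X i))‖, ?_⟩
    rintro _ ⟨x, rfl⟩
    exact ContinuousLinearMap.unit_le_opNorm
      (LinearMap.toContinuousLinearMap (Matrix.toEuclideanLin (X i))) x.1 x.2
  have h2 : ∀ x : EuclideanSpace ℝ (Fin d), ‖x‖ ≤ 1 →
      ‖WithLp.toLp 2 (X i *ᵥ x.ofLp)‖ ≤ maxNorm X := fun x hx =>
    (le_ciSup hb (⟨x, hx⟩ : {x : EuclideanSpace ℝ (Fin d) // ‖x‖ ≤ 1})).trans h1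
  refine Matrix.PosSemidef.of_dotProduct_mulVec_nonneg
    (Matrix.IsHermitian.sub (by simp [Matrix.IsHermitian]) (hX i).1) fun x => ?_
  obtain ⟨y, rfl⟩ : ∃ y : EuclideanSpace ℝ (Fin d), y.ofLp = x := ⟨WithLp.toLp 2 x, rfl⟩
  rw [Matrix.sub_mulVec, Matrix.smul_mulVec, Matrix.one_mulVec, dotProduct_sub,
      dotProduct_smul, quad_eq_inner, norm_sq_eq_dot, smul_eq_mul, sub_nonneg]
  rcases eq_or_ne y 0 with rfl | hy
  · simp
  have hyn : 0 < ‖y‖ := norm_pos_iff.2 hy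
  have h3 := h2 (‖y‖⁻¹ • y) (by rw [norm_smul, norm_inv, norm_norm, inv_mul_cancel₀ hyn.ne'])
  rw [WithLp.ofLp_smul, Matrix.mulVec_smul, WithLp.toLp_smul, norm_smul, norm_inv, norm_norm,
    inv_mul_le_iff₀ hyn] at h3
  have h4 := real_inner_le_norm y (WithLp.toLp 2 (X i *ᵥ y.ofLp))
  nlinarith

/-- One-step Lyapunov right hand side. -/
def lyapRhs {d k N : ℕ} (Q : Fin N → Matrix (Fin d) (Fin d) ℝ) (R : Fin N → Matrix (Fin k) (Fin k) ℝ)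
    (K : Fin N → Matrix (Fin k) (Fin d) ℝ) : Fin N → Matrix (Fin d) (Fin d) ℝ :=
  fun i => Q i + (K i)ᵀ * R i * K i

theorem isLyap_iff {d k N : ℕ} {Pr : Matrix (Fin N) (Fin N) ℝ}
    {A : Fin N → Matrix (Fin d) (Fin d) ℝ} {B : Fin N → Matrix (Fin d) (Fin k) ℝ}
    {Q : Fin N → Matrix (Fin d) (Fin d) ℝ} {R : Fin N → Matrix (Fin k) (Fin k) ℝ}
    {K : Fin N → Matrix (Fin k) (Fin d) ℝ} {P : Fin N → Matrix (Fin d) (Fin d) ℝ} :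
    IsLyap Pr A B Q R K P ↔
      (1 - calA Pr (Gam A B K)) *ᵥ hvec P = hvec (lyapRhs Q R K) := by
  rw [Matrix.sub_mulVec, Matrix.one_mulVec, calA_mulVec, sub_eq_iff_eq_add]
  constructor
  · intro h
    ext ⟨i, a, b⟩
    exact congrFun (congrFun (h i) a) b
  · intro h i
    ext a b
    exact congrFun h (i, a, b)

theorem isLyap_PK {d k N : ℕ} {Pr : Matrix (Fin N) (Fin N) ℝ}
    {A : Fin N → Matrix (Fin d) (Fin d) ℝ} {B : Fin N → Matrix (Fin d) (Fin k) ℝ}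
    (Q : Fin N → Matrix (Fin d) (Fin d) ℝ) (R : Fin N → Matrix (Fin k) (Fin k) ℝ)
    {K : Fin N → Matrix (Fin k) (Fin d) ℝ} (h : (1 - calA Pr (Gam A B K)).det ≠ 0) :
    IsLyap Pr A B Q R K (PK Pr A B Q R K) := by
  have hu : IsUnit (1 - calA Pr (Gam A B K)).det := isUnit_iff_ne_zero.2 h
  have hex : ∃ P, IsLyap Pr A B Q R K P := by
    refine ⟨fun i => Matrix.of fun a b =>
      ((1 - calA Pr (Gam A B K))⁻¹ *ᵥ hvec (lyapRhs Q R K)) (i, a, b), isLyap_iff.2 ?_⟩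
    have : hvec (fun i => Matrix.of fun a b =>
      ((1 - calA Pr (Gam A B K))⁻¹ *ᵥ hvec (lyapRhs Q R K)) (i, a, b)) =
      (1 - calA Pr (Gam A B K))⁻¹ *ᵥ hvec (lyapRhs Q R K) := rfl
    rw [this, Matrix.mulVec_mulVec, Matrix.mul_nonsing_inv _ hu, Matrix.one_mulVec]
  unfold PK
  rw [dif_pos hex]
  exact hex.choose_spec

theorem isLyap_eq {d k N : ℕ} {Pr : Matrix (Fin N) (Fin N) ℝ}
    {A : Fin N → Matrix (Fin d) (Fin d) ℝ} {B : Fin N → Matrix (Fin d) (Fin k) ℝ}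
    {Q : Fin N → Matrix (Fin d) (Fin d) ℝ} {R : Fin N → Matrix (Fin k) (Fin k) ℝ}
    {K : Fin N → Matrix (Fin k) (Fin d) ℝ} (h : (1 - calA Pr (Gam A B K)).det ≠ 0)
    {P : Fin N → Matrix (Fin d) (Fin d) ℝ} (hP : IsLyap Pr A B Q R K P) :
    hvec P = (1 - calA Pr (Gam A B K))⁻¹ *ᵥ hvec (lyapRhs Q R K) := by
  have hu : IsUnit (1 - calA Pr (Gam A B K)).det := isUnit_iff_ne_zero.2 h
  rw [← isLyap_iff.1 hP, Matrix.mulVec_mulVec, Matrix.nonsing_inv_mul _ hu, Matrix.one_mulVec]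

theorem opE_add {d N : ℕ} (Pr : Matrix (Fin N) (Fin N) ℝ)
    (V W : Fin N → Matrix (Fin d) (Fin d) ℝ) : opE Pr (V + W) = opE Pr V + opE Pr W := by
  ext1 i
  simp [opE, Finset.sum_add_distrib]

theorem opE_sub {d N : ℕ} (Pr : Matrix (Fin N) (Fin N) ℝ)
    (V W : Fin N → Matrix (Fin d) (Fin d) ℝ) : opE Pr (V - W) = opE Pr V - opE Pr W := by
  ext1 i
  simp [opE, smul_sub, Finset.sum_sub_distrib]

theorem opE_psd {d N : ℕ} {Pr : Matrix (Fin N) (Fin N) ℝ} (hPr : ∀ i j, 0 ≤ Pr i j)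
    {V : Fin N → Matrix (Fin d) (Fin d) ℝ} (hV : ∀ i, (V i).PosSemidef) (i : Fin N) :
    (opE Pr V i).PosSemidef :=
  Matrix.posSemidef_sum _ fun j _ => (hV j).smul (hPr i j)

theorem opL_psd {d N : ℕ} {Pr : Matrix (Fin N) (Fin N) ℝ} (hPr : ∀ i j, 0 ≤ Pr i j)
    (Γ : Fin N → Matrix (Fin d) (Fin d) ℝ)
    {V : Fin N → Matrix (Fin d) (Fin d) ℝ} (hV : ∀ i, (V i).PosSemidef) (i : Fin N) :
    (opL Pr Γ V i).PosSemidef := psd_conj (opE_psd hPr hV i) _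

theorem opT_psd {d N : ℕ} {Pr : Matrix (Fin N) (Fin N) ℝ} (hPr : ∀ i j, 0 ≤ Pr i j)
    (Γ : Fin N → Matrix (Fin d) (Fin d) ℝ)
    {V : Fin N → Matrix (Fin d) (Fin d) ℝ} (hV : ∀ i, (V i).PosSemidef) (i : Fin N) :
    (opT Pr Γ V i).PosSemidef :=
  Matrix.posSemidef_sum _ fun j _ => (psd_conj' (hV j) _).smul (hPr j i)

theorem iterate_psd {d N : ℕ}
    (F : (Fin N → Matrix (Fin d) (Fin d) ℝ) → (Fin N → Matrix (Fin d) (Fin d) ℝ))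
    (hF : ∀ V, (∀ i, (V i).PosSemidef) → ∀ i, (F V i).PosSemidef)
    {V : Fin N → Matrix (Fin d) (Fin d) ℝ} (hV : ∀ i, (V i).PosSemidef) (n : ℕ) :
    ∀ i, (F^[n] V i).PosSemidef := by
  induction n with
  | zero => simpa using hV
  | succ n ih => rw [Function.iterate_succ_apply']; exact hF _ ih

theorem PK_psd {d k N : ℕ} {Pr : Matrix (Fin N) (Fin N) ℝ} (hPr : ∀ i j, 0 ≤ Pr i j)
    {A : Fin N → Matrix (Fin d) (Fin d) ℝ} {B : Fin N → Matrix (Fin d) (Fin k) ℝ}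
    {Q : Fin N → Matrix (Fin d) (Fin d) ℝ} {R : Fin N → Matrix (Fin k) (Fin k) ℝ}
    (hQ : ∀ i, (Q i).PosDef) (hR : ∀ i, (R i).PosDef)
    {K : Fin N → Matrix (Fin k) (Fin d) ℝ} (hK : MSS Pr A B K) (i : Fin N) :
    (PK Pr A B Q R K i).PosSemidef := by
  have hq : ∀ i, (lyapRhs Q R K i).PosSemidef := fun i =>
    (hQ i).posSemidef.add (psd_conj (hR i).posSemidef _)
  have hs := opL_summable hK (lyapRhs Q R K)
  have hfix := tsum_iterate_eq (opL Pr (Gam A B K))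
    (by intro V W; ext1 i; simp [opL, opE_add, Matrix.mul_add, Matrix.add_mul])
    (by unfold opL opE; fun_prop) _ hs
  set S := ∑' n : ℕ, (opL Pr (Gam A B K))^[n] (lyapRhs Q R K) with hS
  have hL : IsLyap Pr A B Q R K S := fun i => by
    conv_lhs => rw [hfix]
    rfl
  have hdet := det_ne_zero_of_MSS hK
  have heq : PK Pr A B Q R K = S := by
    have := (isLyap_eq hdet (isLyap_PK Q R hdet)).trans (isLyap_eq hdet hL).symm
    ext i a b
    exact congrFun this (i, a, b)
  rw [heq]
  exact psd_of_hasSum (Pi.hasSum.1 hs.hasSum i)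
    fun n => iterate_psd _ (fun V hV => opL_psd hPr _ hV) hq n i

theorem XK_spec {d k N : ℕ} {Pr : Matrix (Fin N) (Fin N) ℝ} (hPr : ∀ i j, 0 ≤ Pr i j)
    {A : Fin N → Matrix (Fin d) (Fin d) ℝ} {B : Fin N → Matrix (Fin d) (Fin k) ℝ}
    {piv : Fin N → ℝ} (hpiv : ∀ i, 0 < piv i) {Sg : Matrix (Fin d) (Fin d) ℝ} (hSg : Sg.PosDef)
    {K : Fin N → Matrix (Fin k) (Fin d) ℝ} (hK : MSS Pr A B K) :
    (∀ i, (XK Pr piv Sg (Gam A B K) i).PosSemidef) ∧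
    XK Pr piv Sg (Gam A B K) =
      (fun i => piv i • Sg) + opT Pr (Gam A B K) (XK Pr piv Sg (Gam A B K)) := by
  have hs := opT_summable hK (fun i => piv i • Sg)
  constructor
  · intro i
    exact psd_of_hasSum (Pi.hasSum.1 hs.hasSum i)
      fun n => iterate_psd _ (fun V hV => opT_psd hPr _ hV)
        (fun i => hSg.posSemidef.smul (hpiv i).le) n i
  · exact tsum_iterate_eq (opT Pr (Gam A B K))
      (by intro V W; ext1 i
          simp [opT, Matrix.mul_add, Matrix.add_mul, Finset.sum_add_distrib])
      (by unfold opT; fun_prop) _ hs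

theorem adjoint_LT {d N : ℕ} (Pr : Matrix (Fin N) (Fin N) ℝ)
    (Γ D X : Fin N → Matrix (Fin d) (Fin d) ℝ) :
    ∑ i, (D i * opT Pr Γ X i).trace = ∑ i, (opL Pr Γ D i * X i).trace := by
  simp only [opT, opL, opE, Matrix.mul_sum, Matrix.sum_mul, Matrix.trace_sum]
  rw [Finset.sum_comm]
  refine Finset.sum_congr rfl fun i _ => Finset.sum_congr rfl fun j _ => ?_
  simp only [Matrix.mul_smul, Matrix.smul_mul, Matrix.trace_smul]
  congr 1
  rw [← Matrix.mul_assoc, Matrix.trace_mul_comm]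
  simp only [Matrix.mul_assoc]

/-- Cost difference identity: `K'` with Lyapunov solution `P'`, `K` with solution `P`. -/
theorem cost_diff {d k N : ℕ} {Pr : Matrix (Fin N) (Fin N) ℝ}
    {A : Fin N → Matrix (Fin d) (Fin d) ℝ} {B : Fin N → Matrix (Fin d) (Fin k) ℝ}
    {Q : Fin N → Matrix (Fin d) (Fin d) ℝ} {R : Fin N → Matrix (Fin k) (Fin k) ℝ}
    {piv : Fin N → ℝ} {Sg : Matrix (Fin d) (Fin d) ℝ}
    {K K' : Fin N → Matrix (Fin k) (Fin d) ℝ} {P P' X : Fin N → Matrix (Fin d) (Fin d) ℝ}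
    (hP : IsLyap Pr A B Q R K P) (hP' : IsLyap Pr A B Q R K' P')
    (hX : X = (fun i => piv i • Sg) + opT Pr (Gam A B K) X) :
    ∑ i, piv i * (P' i * Sg).trace - ∑ i, piv i * (P i * Sg).trace =
      ∑ i, (((K' i - K i)ᵀ * (R i + (B i)ᵀ * opE Pr P' i * B i) * (K' i - K i)
        + (K' i - K i)ᵀ * ((R i + (B i)ᵀ * opE Pr P' i * B i) * K i - (B i)ᵀ * opE Pr P' i * A i)
        + ((K i)ᵀ * (R i + (B i)ᵀ * opE Pr P' i * B i) - (A i)ᵀ * opE Pr P' i * B i)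
          * (K' i - K i)) * X i).trace := by
  set D := P' - P with hD
  have h1 : ∑ i, piv i * (P' i * Sg).trace - ∑ i, piv i * (P i * Sg).trace
      = ∑ i, (D i * (X i - opT Pr (Gam A B K) X i)).trace := by
    rw [← Finset.sum_sub_distrib]
    refine Finset.sum_congr rfl fun i _ => ?_
    have : X i - opT Pr (Gam A B K) X i = piv i • Sg := by
      rw [sub_eq_iff_eq_add]
      exact congrFun hX i
    rw [this, hD]
    simp [Matrix.sub_mul, mul_sub]
  rw [h1]
  simp only [Matrix.mul_sub, Matrix.trace_sub, Finset.sum_sub_distrib]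
  rw [adjoint_LT, ← Finset.sum_sub_distrib]
  refine Finset.sum_congr rfl fun i _ => ?_
  rw [← Matrix.trace_sub, ← Matrix.sub_mul]
  congr 2
  have e1 : D i = P' i - P i := rfl
  rw [e1, hP i, hP' i]
  simp only [opL, hD, opE_sub, Pi.sub_apply, Gam]
  generalize opE Pr P' i = E'
  generalize opE Pr P i = E
  simp only [Matrix.mul_sub, Matrix.sub_mul, Matrix.mul_add, Matrix.add_mul,
    Matrix.transpose_sub, Matrix.transpose_mul, Matrix.mul_assoc]
  abel

theorem completion_of_squares {d k : ℕ} {A E : Matrix (Fin d) (Fin d) ℝ}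
    {B : Matrix (Fin d) (Fin k) ℝ} {Ψ : Matrix (Fin k) (Fin k) ℝ} (hΨ : Ψ.PosDef)
    (hE : Eᵀ = E) (K Ks : Matrix (Fin k) (Fin d) ℝ) :
    (K - Ks)ᵀ * Ψ * (K - Ks) + (K - Ks)ᵀ * (Ψ * Ks - Bᵀ * E * A)
      + (Ksᵀ * Ψ - Aᵀ * E * B) * (K - Ks) =
    (Ψ * K - Bᵀ * E * A)ᵀ * Ψ⁻¹ * (Ψ * K - Bᵀ * E * A)
      - (K - Ks - Ψ⁻¹ * (Ψ * K - Bᵀ * E * A))ᵀ * Ψ * (K - Ks - Ψ⁻¹ * (Ψ * K - Bᵀ * E * A)) := by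
  have hsymm : Ψᵀ = Ψ := by simpa using hΨ.1.eq
  have hu : IsUnit Ψ.det := (Matrix.isUnit_iff_isUnit_det _).1 hΨ.isUnit
  obtain ⟨Z, hZ⟩ : ∃ Z, Z = Ψ⁻¹ * (Ψ * K - Bᵀ * E * A) := ⟨_, rfl⟩
  have hL : Ψ * K - Bᵀ * E * A = Ψ * Z := by
    rw [hZ, ← Matrix.mul_assoc, Matrix.mul_nonsing_inv _ hu, Matrix.one_mul]
  have h1 : Bᵀ * E * A = Ψ * K - Ψ * Z := by rw [← hL]; abel
  have h2 : Aᵀ * E * B = Kᵀ * Ψ - Zᵀ * Ψ := by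
    have := congrArg Matrix.transpose h1
    simpa only [Matrix.transpose_mul, Matrix.transpose_sub, Matrix.transpose_transpose, hE, hsymm,
      Matrix.mul_assoc] using this
  rw [Matrix.mul_assoc (Ψ * K - Bᵀ * E * A)ᵀ, ← hZ, hL, h1, h2]
  simp only [Matrix.mul_sub, Matrix.sub_mul, Matrix.transpose_sub, Matrix.transpose_mul, hsymm,
    Matrix.mul_assoc]
  abel

theorem trace_inv_le {d k : ℕ} {Ψ : Matrix (Fin k) (Fin k) ℝ} (hΨ : Ψ.PosDef) {c : ℝ} (hc : 0 < c)
    (hcΨ : (Ψ - c • (1 : Matrix (Fin k) (Fin k) ℝ)).PosSemidef) (L : Matrix (Fin k) (Fin d) ℝ) :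
    (Lᵀ * Ψ⁻¹ * L).trace ≤ c⁻¹ * (Lᵀ * L).trace := by
  have hsymm : Ψᵀ = Ψ := by simpa using hΨ.1.eq
  have hu : IsUnit Ψ.det := (Matrix.isUnit_iff_isUnit_det _).1 hΨ.isUnit
  obtain ⟨Z, hZ⟩ : ∃ Z, Z = Ψ⁻¹ * L := ⟨_, rfl⟩
  have hL : L = Ψ * Z := by
    rw [hZ, ← Matrix.mul_assoc, Matrix.mul_nonsing_inv _ hu, Matrix.one_mul]
  have hLt : Lᵀ = Zᵀ * Ψ := by rw [hL, Matrix.transpose_mul, hsymm]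
  rw [Matrix.mul_assoc, ← hZ]
  have h1 := trace_gram_nonneg (L - c • Z)
  have h2 := (psd_conj hcΨ Z).trace_nonneg
  have h3 : (Zᵀ * L).trace = (Lᵀ * Z).trace := by
    rw [← Matrix.trace_transpose, Matrix.transpose_mul, Matrix.transpose_transpose]
  simp only [Matrix.mul_sub, Matrix.sub_mul, Matrix.transpose_sub, Matrix.transpose_smul,
    Matrix.trace_sub, Matrix.smul_mul, Matrix.mul_smul, Matrix.trace_smul, smul_eq_mul,
    Matrix.mul_one, ← hLt, h3] at h1 h2
  rw [← div_eq_inv_mul, le_div_iff₀ hc]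
  nlinarith

theorem trace_mul_sq_ge {d k : ℕ} {X : Matrix (Fin d) (Fin d) ℝ} {m : ℝ} (hm : 0 ≤ m)
    (hX : (X - m • (1 : Matrix (Fin d) (Fin d) ℝ)).PosSemidef) (L : Matrix (Fin k) (Fin d) ℝ) :
    m ^ 2 * (Lᵀ * L).trace ≤ ((L * X)ᵀ * (L * X)).trace := by
  set Y := X - m • (1 : Matrix (Fin d) (Fin d) ℝ) with hY
  have hXY : X = Y + m • (1 : Matrix (Fin d) (Fin d) ℝ) := by rw [hY]; abel
  have hs : Yᵀ = Y := by simpa using hX.1.eq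
  have h1 := trace_gram_nonneg (L * Y)
  have h2 := (psd_conj' hX L).trace_nonneg
  have h3 : (L * Y * Lᵀ).trace = (Y * (Lᵀ * L)).trace := by
    rw [Matrix.mul_assoc, Matrix.trace_mul_comm, Matrix.mul_assoc]
  have h4 : (Lᵀ * (L * Y)).trace = (Y * (Lᵀ * L)).trace := by
    rw [← Matrix.mul_assoc, Matrix.trace_mul_comm]
  have h5 : ((L * X)ᵀ * (L * X)).trace = ((L * Y)ᵀ * (L * Y)).trace
      + 2 * m * (L * Y * Lᵀ).trace + m ^ 2 * (Lᵀ * L).trace := by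
    rw [h3, hXY]
    simp only [Matrix.mul_add, Matrix.transpose_add, Matrix.add_mul, Matrix.mul_smul,
      Matrix.mul_one, Matrix.transpose_smul, Matrix.smul_mul, Matrix.trace_add, Matrix.trace_smul,
      smul_eq_mul, Matrix.transpose_mul, hs, Matrix.mul_assoc, h4]
    ring
  rw [h5]
  have : 0 ≤ 2 * m * (L * Y * Lᵀ).trace := by positivity
  linarith

/-- The difference quotient of the cost along a line, as a function of `t` and the
Lyapunov solution. -/
def quotFun {d k N : ℕ} (Pr : Matrix (Fin N) (Fin N) ℝ)
    (A : Fin N → Matrix (Fin d) (Fin d) ℝ) (B : Fin N → Matrix (Fin d) (Fin k) ℝ)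
    (R : Fin N → Matrix (Fin k) (Fin k) ℝ) (K E : Fin N → Matrix (Fin k) (Fin d) ℝ)
    (X : Fin N → Matrix (Fin d) (Fin d) ℝ) (p : ℝ × (Fin N → Matrix (Fin d) (Fin d) ℝ)) : ℝ :=
  ∑ i, ((p.1 • ((E i)ᵀ * (R i + (B i)ᵀ * opE Pr p.2 i * B i) * E i)
        + (E i)ᵀ * ((R i + (B i)ᵀ * opE Pr p.2 i * B i) * K i - (B i)ᵀ * opE Pr p.2 i * A i)
        + ((K i)ᵀ * (R i + (B i)ᵀ * opE Pr p.2 i * B i) - (A i)ᵀ * opE Pr p.2 i * B i)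
          * E i) * X i).trace

theorem quotFun_continuous {d k N : ℕ} (Pr : Matrix (Fin N) (Fin N) ℝ)
    (A : Fin N → Matrix (Fin d) (Fin d) ℝ) (B : Fin N → Matrix (Fin d) (Fin k) ℝ)
    (R : Fin N → Matrix (Fin k) (Fin k) ℝ) (K E : Fin N → Matrix (Fin k) (Fin d) ℝ)
    (X : Fin N → Matrix (Fin d) (Fin d) ℝ) : Continuous (quotFun Pr A B R K E X) := by
  unfold quotFun opE
  fun_prop

theorem cost_line {d k N : ℕ} {Pr : Matrix (Fin N) (Fin N) ℝ}
    {A : Fin N → Matrix (Fin d) (Fin d) ℝ} {B : Fin N → Matrix (Fin d) (Fin k) ℝ}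
    {Q : Fin N → Matrix (Fin d) (Fin d) ℝ} {R : Fin N → Matrix (Fin k) (Fin k) ℝ}
    {piv : Fin N → ℝ} {Sg : Matrix (Fin d) (Fin d) ℝ}
    {K E : Fin N → Matrix (Fin k) (Fin d) ℝ} {X : Fin N → Matrix (Fin d) (Fin d) ℝ} (t : ℝ)
    (hP : IsLyap Pr A B Q R K (PK Pr A B Q R K))
    (hP' : IsLyap Pr A B Q R (K + t • E) (PK Pr A B Q R (K + t • E)))
    (hX : X = (fun i => piv i • Sg) + opT Pr (Gam A B K) X) :
    cost Pr A B Q R piv Sg (K + t • E) - cost Pr A B Q R piv Sg K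
      = t * quotFun Pr A B R K E X (t, PK Pr A B Q R (K + t • E)) := by
  unfold cost quotFun
  rw [cost_diff hP hP' hX, Finset.mul_sum]
  refine Finset.sum_congr rfl fun i _ => ?_
  rw [← smul_eq_mul t, ← Matrix.trace_smul, ← Matrix.smul_mul]
  congr 2
  have : (K + t • E) i - K i = t • E i := by simp
  rw [this]
  simp only [Matrix.transpose_smul, Matrix.smul_mul, Matrix.mul_smul, smul_add]

theorem quotFun_zero {d k N : ℕ} {Pr : Matrix (Fin N) (Fin N) ℝ}
    {A : Fin N → Matrix (Fin d) (Fin d) ℝ} {B : Fin N → Matrix (Fin d) (Fin k) ℝ}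
    {Q : Fin N → Matrix (Fin d) (Fin d) ℝ} {R : Fin N → Matrix (Fin k) (Fin k) ℝ}
    {K E : Fin N → Matrix (Fin k) (Fin d) ℝ} {X : Fin N → Matrix (Fin d) (Fin d) ℝ}
    (hR : ∀ i, (R i)ᵀ = R i) (hE : ∀ i, (opE Pr (PK Pr A B Q R K) i)ᵀ = opE Pr (PK Pr A B Q R K) i)
    (hX : ∀ i, (X i)ᵀ = X i) :
    quotFun Pr A B R K E X (0, PK Pr A B Q R K)
      = ip (fun i => (2 : ℝ) • (LK Pr A B Q R K i * X i)) E := by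
  unfold quotFun ip
  refine Finset.sum_congr rfl fun i _ => ?_
  have h1 : (K i)ᵀ * (R i + (B i)ᵀ * opE Pr (PK Pr A B Q R K) i * B i)
      - (A i)ᵀ * opE Pr (PK Pr A B Q R K) i * B i = (LK Pr A B Q R K i)ᵀ := by
    simp only [LK, Matrix.transpose_sub, Matrix.transpose_mul, Matrix.transpose_add, hR, hE,
      Matrix.transpose_transpose, Matrix.mul_assoc]
  have h2 : (R i + (B i)ᵀ * opE Pr (PK Pr A B Q R K) i * B i) * K i
    - (B i)ᵀ * opE Pr (PK Pr A B Q R K) i * A i = LK Pr A B Q R K i := rfl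
  simp only [h1, h2, zero_smul, zero_add]
  generalize LK Pr A B Q R K i = L
  have h3 : (Lᵀ * E i * X i).trace = ((L * X i)ᵀ * E i).trace := by
    rw [Matrix.trace_mul_comm, Matrix.transpose_mul, hX, Matrix.mul_assoc]
  have h4 : ((E i)ᵀ * L * X i).trace = ((L * X i)ᵀ * E i).trace := by
    rw [← Matrix.trace_transpose]
    simp only [Matrix.transpose_mul, Matrix.transpose_transpose, Matrix.mul_assoc]
  rw [Matrix.add_mul, Matrix.trace_add, h3, h4, Matrix.transpose_smul, Matrix.smul_mul,
    Matrix.trace_smul, smul_eq_mul, two_mul]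

theorem ip_ext {a b N : ℕ} {G M : Fin N → Matrix (Fin a) (Fin b) ℝ}
    (h : ∀ E, ip G E = ip M E) : G = M := by
  have h1 : ip (G - M) (G - M) = 0 := by
    have := h (G - M)
    have e : ip (G - M) (G - M) = ip G (G - M) - ip M (G - M) := by
      simp only [ip, Pi.sub_apply, Matrix.transpose_sub, Matrix.sub_mul, Matrix.trace_sub,
        Finset.sum_sub_distrib]
    rw [e, this, sub_self]
  have h2 := (Finset.sum_eq_zero_iff_of_nonneg
    (fun i _ => trace_gram_nonneg ((G - M) i))).1 h1
  ext1 i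
  have h3 := h2 i (Finset.mem_univ i)
  rw [← Matrix.conjTranspose_eq_transpose_of_trivial] at h3
  have h4 : (G - M) i = 0 := Matrix.trace_conjTranspose_mul_self_eq_zero_iff.1 h3
  exact sub_eq_zero.1 h4

/-! ### Differentiability -/

theorem differentiableAt_det {F ι : Type*} [NormedAddCommGroup F] [NormedSpace ℝ F] [Fintype ι]
    [DecidableEq ι] {M : F → Matrix ι ι ℝ} {x : F}
    (h : ∀ i j, DifferentiableAt ℝ (fun y => M y i j) x) :
    DifferentiableAt ℝ (fun y => (M y).det) x := by
  simp only [Matrix.det_apply']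
  refine DifferentiableAt.fun_sum fun σ _ => DifferentiableAt.const_mul ?_ _
  exact (HasFDerivAt.finsetProd (u := Finset.univ) fun i _ => (h (σ i) i).hasFDerivAt).differentiableAt

theorem differentiableAt_inv_entry {F ι : Type*} [NormedAddCommGroup F] [NormedSpace ℝ F]
    [Fintype ι] [DecidableEq ι] {M : F → Matrix ι ι ℝ} {x : F}
    (h : ∀ i j, DifferentiableAt ℝ (fun y => M y i j) x) (h0 : (M x).det ≠ 0) (i j : ι) :
    DifferentiableAt ℝ (fun y => (M y)⁻¹ i j) x := by
  simp only [Matrix.inv_def, Ring.inverse_eq_inv', Matrix.smul_apply, smul_eq_mul,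
    Matrix.adjugate_apply]
  refine ((differentiableAt_det h).inv h0).mul (differentiableAt_det fun a b => ?_)
  simp only [Matrix.updateRow_apply]
  split_ifs
  · exact differentiableAt_const _
  · exact h a b

attribute [local instance] Matrix.normedAddCommGroup Matrix.normedSpace

theorem diff_entry {a b N : ℕ} (K : Fin N → Matrix (Fin a) (Fin b) ℝ) (i : Fin N) (x : Fin a)
    (y : Fin b) : DifferentiableAt ℝ (fun K' : Fin N → Matrix (Fin a) (Fin b) ℝ => K' i x y) K := by
  have h1 : DifferentiableAt ℝ (fun K' : Fin N → Matrix (Fin a) (Fin b) ℝ => K' i) K :=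
    differentiableAt_apply i K
  have h2 : DifferentiableAt ℝ (fun M : Matrix (Fin a) (Fin b) ℝ => M x y) (K i) :=
    (LinearMap.toContinuousLinearMap (Matrix.entryLinearMap ℝ ℝ x y)).differentiableAt
  exact h2.comp K h1

theorem PK_diff {d k N : ℕ} {Pr : Matrix (Fin N) (Fin N) ℝ}
    {A : Fin N → Matrix (Fin d) (Fin d) ℝ} {B : Fin N → Matrix (Fin d) (Fin k) ℝ}
    (Q : Fin N → Matrix (Fin d) (Fin d) ℝ) (R : Fin N → Matrix (Fin k) (Fin k) ℝ)
    {K : Fin N → Matrix (Fin k) (Fin d) ℝ} (h : (1 - calA Pr (Gam A B K)).det ≠ 0) :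
    (∀ᶠ K' in 𝓝 K, (1 - calA Pr (Gam A B K')).det ≠ 0) ∧
    ∀ i a b, DifferentiableAt ℝ (fun K' => PK Pr A B Q R K' i a b) K := by
  have hG : ∀ i a b, DifferentiableAt ℝ
      (fun K' : Fin N → Matrix (Fin k) (Fin d) ℝ => Gam A B K' i a b) K := by
    intro i a b
    simp only [Gam, Matrix.sub_apply, Matrix.mul_apply]
    exact (differentiableAt_const _).sub
      (DifferentiableAt.fun_sum fun j _ => (diff_entry K i j b).const_mul _)
  have hM : ∀ p q, DifferentiableAt ℝ
      (fun K' : Fin N → Matrix (Fin k) (Fin d) ℝ => (1 - calA Pr (Gam A B K')) p q) K := by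
    rintro ⟨i, a, b⟩ ⟨j, c, e⟩
    simp only [Matrix.sub_apply, calA_apply]
    exact (differentiableAt_const _).sub (((hG i c a).const_mul _).mul (hG i e b))
  have hev : ∀ᶠ K' in 𝓝 K, (1 - calA Pr (Gam A B K')).det ≠ 0 :=
    (differentiableAt_det hM).continuousAt.eventually_ne h
  refine ⟨hev, fun i a b => ?_⟩
  have hq : ∀ p, DifferentiableAt ℝ
      (fun K' : Fin N → Matrix (Fin k) (Fin d) ℝ => hvec (lyapRhs Q R K') p) K := by
    rintro ⟨i, a, b⟩
    simp only [hvec, lyapRhs, Matrix.add_apply, Matrix.mul_apply, Matrix.transpose_apply]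
    exact (differentiableAt_const _).add (DifferentiableAt.fun_sum fun j _ =>
      (DifferentiableAt.fun_sum fun l _ => (diff_entry K i l a).mul_const _).mul (diff_entry K i j b))
  have heq : (fun K' => PK Pr A B Q R K' i a b) =ᶠ[𝓝 K]
      fun K' => ((1 - calA Pr (Gam A B K'))⁻¹ *ᵥ hvec (lyapRhs Q R K')) (i, a, b) := by
    filter_upwards [hev] with K' hK'
    exact congrFun (isLyap_eq hK' (isLyap_PK Q R hK')) (i, a, b)
  refine DifferentiableAt.congr_of_eventuallyEq ?_ heq
  simp only [Matrix.mulVec, dotProduct]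
  exact DifferentiableAt.fun_sum fun q _ => (differentiableAt_inv_entry hM h _ _).mul (hq q)

theorem cost_diffAt {d k N : ℕ} {Pr : Matrix (Fin N) (Fin N) ℝ}
    {A : Fin N → Matrix (Fin d) (Fin d) ℝ} {B : Fin N → Matrix (Fin d) (Fin k) ℝ}
    (Q : Fin N → Matrix (Fin d) (Fin d) ℝ) (R : Fin N → Matrix (Fin k) (Fin k) ℝ)
    (piv : Fin N → ℝ) (Sg : Matrix (Fin d) (Fin d) ℝ)
    {K : Fin N → Matrix (Fin k) (Fin d) ℝ} (h : (1 - calA Pr (Gam A B K)).det ≠ 0) :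
    DifferentiableAt ℝ (cost Pr A B Q R piv Sg) K := by
  have h1 := (PK_diff Q R h).2
  have : cost Pr A B Q R piv Sg = fun K' => ∑ i, piv i *
      ∑ a, ∑ b, PK Pr A B Q R K' i a b * Sg b a := by
    ext K'
    simp [cost, Matrix.trace, Matrix.mul_apply]
  rw [this]
  exact DifferentiableAt.fun_sum fun i _ => (DifferentiableAt.fun_sum fun a _ =>
    DifferentiableAt.fun_sum fun b _ => (h1 i a b).mul_const _).const_mul _

theorem fderiv_cost {d k N : ℕ} {Pr : Matrix (Fin N) (Fin N) ℝ}
    {A : Fin N → Matrix (Fin d) (Fin d) ℝ} {B : Fin N → Matrix (Fin d) (Fin k) ℝ}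
    (Q : Fin N → Matrix (Fin d) (Fin d) ℝ) (R : Fin N → Matrix (Fin k) (Fin k) ℝ)
    (piv : Fin N → ℝ) (Sg : Matrix (Fin d) (Fin d) ℝ)
    {K : Fin N → Matrix (Fin k) (Fin d) ℝ} (h : (1 - calA Pr (Gam A B K)).det ≠ 0)
    {X : Fin N → Matrix (Fin d) (Fin d) ℝ}
    (hX : X = (fun i => piv i • Sg) + opT Pr (Gam A B K) X)
    (E : Fin N → Matrix (Fin k) (Fin d) ℝ) :
    fderiv ℝ (cost Pr A B Q R piv Sg) K E
      = quotFun Pr A B R K E X (0, PK Pr A B Q R K) := by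
  have h1 : HasDerivAt (fun t : ℝ => cost Pr A B Q R piv Sg (K + t • E))
      (fderiv ℝ (cost Pr A B Q R piv Sg) K E) 0 :=
    (cost_diffAt Q R piv Sg h).hasFDerivAt.hasLineDerivAt E
  have hline : ContinuousAt (fun t : ℝ => K + t • E) 0 := by
    have : Continuous (fun t : ℝ => K + t • E) := by fun_prop
    exact this.continuousAt
  have h00 : K + (0 : ℝ) • E = K := by simp
  have hline' : Tendsto (fun t : ℝ => K + t • E) (𝓝 0) (𝓝 K) := by
    have := hline.tendsto
    simp only [h00] at this
    exact this
  have hPc : Tendsto (fun t : ℝ => PK Pr A B Q R (K + t • E)) (𝓝 0) (𝓝 (PK Pr A B Q R K)) := by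
    refine tendsto_pi_nhds.2 fun i => tendsto_pi_nhds.2 fun a => tendsto_pi_nhds.2 fun b => ?_
    exact ((PK_diff Q R h).2 i a b).continuousAt.tendsto.comp hline'
  have hq : Tendsto (fun t : ℝ => quotFun Pr A B R K E X (t, PK Pr A B Q R (K + t • E))) (𝓝 0)
      (𝓝 (quotFun Pr A B R K E X (0, PK Pr A B Q R K))) :=
    ((quotFun_continuous Pr A B R K E X).tendsto (0, PK Pr A B Q R K)).comp
      (tendsto_id.prodMk_nhds hPc)
  have h2 := hasDerivAt_iff_tendsto_slope_zero.1 h1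
  refine tendsto_nhds_unique h2 ((hq.mono_left nhdsWithin_le_nhds).congr' ?_)
  filter_upwards [(hline'.eventually (PK_diff Q R h).1).filter_mono nhdsWithin_le_nhds,
    self_mem_nhdsWithin] with t ht ht0
  have ht0' : t ≠ 0 := ht0
  rw [zero_add, h00, cost_line t (isLyap_PK Q R h) (isLyap_PK Q R ht) hX, smul_eq_mul,
    inv_mul_cancel_left₀ ht0']

/-- gradient dominance. -/
theorem gradient_dominance
    (d k N : ℕ) (hd : 0 < d) (hk : 0 < k) (hN : 0 < N)
    (A : Fin N → Matrix (Fin d) (Fin d) ℝ) (B : Fin N → Matrix (Fin d) (Fin k) ℝ)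
    (Pr : Matrix (Fin N) (Fin N) ℝ)
    (hPr : ∀ i j, 0 ≤ Pr i j) (hPrSum : ∀ i, ∑ j, Pr i j = 1)
    (piv : Fin N → ℝ) (hpiv : ∀ i, 0 < piv i) (hpivSum : ∑ i, piv i = 1)
    (Sg : Matrix (Fin d) (Fin d) ℝ) (hSg : Sg.PosDef)
    (Q : Fin N → Matrix (Fin d) (Fin d) ℝ) (hQ : ∀ i, (Q i).PosDef)
    (R : Fin N → Matrix (Fin k) (Fin k) ℝ) (hR : ∀ i, (R i).PosDef)
    (K : Fin N → Matrix (Fin k) (Fin d) ℝ) (hK : MSS Pr A B K)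
    (G : Fin N → Matrix (Fin k) (Fin d) ℝ)
    (hG : ∀ E : Fin N → Matrix (Fin k) (Fin d) ℝ, fderiv ℝ (cost Pr A B Q R piv Sg) K E = ip G E)
    (Ks : Fin N → Matrix (Fin k) (Fin d) ℝ) (hKs : MSS Pr A B Ks)
    (hopt : ∀ K' : Fin N → Matrix (Fin k) (Fin d) ℝ, MSS Pr A B K' → cost Pr A B Q R piv Sg Ks ≤ cost Pr A B Q R piv Sg K') :
    cost Pr A B Q R piv Sg K - cost Pr A B Q R piv Sg Ks
      ≤ maxNorm (XK Pr piv Sg (Gam A B Ks)) *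
          ∑ i, ((LK Pr A B Q R K i)ᵀ
            * (R i + (B i)ᵀ * opE Pr (PK Pr A B Q R K) i * B i)⁻¹
            * LK Pr A B Q R K i).trace ∧
    maxNorm (XK Pr piv Sg (Gam A B Ks)) *
        ∑ i, ((LK Pr A B Q R K i)ᵀ
          * (R i + (B i)ᵀ * opE Pr (PK Pr A B Q R K) i * B i)⁻¹
          * LK Pr A B Q R K i).trace
      ≤ maxNorm (XK Pr piv Sg (Gam A B Ks)) / lamMin R * norm2sq (LK Pr A B Q R K) ∧
    maxNorm (XK Pr piv Sg (Gam A B Ks)) / lamMin R * norm2sq (LK Pr A B Q R K)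
      ≤ maxNorm (XK Pr piv Sg (Gam A B Ks)) / (4 * mu piv Sg ^ 2 * lamMin R) * norm2sq G := by
  have hdet := det_ne_zero_of_MSS hK
  have hdets := det_ne_zero_of_MSS hKs
  have hP := isLyap_PK Q R hdet
  have hPs := isLyap_PK Q R hdets
  have hEpsd := opE_psd hPr (PK_psd hPr hQ hR hK)
  obtain ⟨hXspsd, hXs⟩ := XK_spec hPr hpiv hSg hKs
  obtain ⟨hXpsd, hX⟩ := XK_spec hPr hpiv hSg hK
  obtain ⟨hlam, hRlam⟩ := lamMin_spec hk hN hR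
  obtain ⟨hmu, hSgmu⟩ := mu_spec hd hN hpiv hSg
  have hcpsd := maxNorm_spec hXspsd
  have hBpsd : ∀ i, ((B i)ᵀ * opE Pr (PK Pr A B Q R K) i * B i).PosSemidef :=
    fun i => psd_conj (hEpsd i) _
  have hΨ : ∀ i, (R i + (B i)ᵀ * opE Pr (PK Pr A B Q R K) i * B i).PosDef :=
    fun i => (hR i).add_posSemidef (hBpsd i)
  have hΨlam : ∀ i, (R i + (B i)ᵀ * opE Pr (PK Pr A B Q R K) i * B i
      - lamMin R • (1 : Matrix (Fin k) (Fin k) ℝ)).PosSemidef := fun i => by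
    have := (hRlam i).add (hBpsd i)
    rwa [sub_add_eq_add_sub] at this
  have hEs : ∀ i, (opE Pr (PK Pr A B Q R K) i)ᵀ = opE Pr (PK Pr A B Q R K) i :=
    fun i => by simpa using (hEpsd i).1.eq
  have hc : 0 ≤ maxNorm (XK Pr piv Sg (Gam A B Ks)) :=
    Real.iSup_nonneg fun i => Real.iSup_nonneg fun x => norm_nonneg _
  refine ⟨?_, ?_, ?_⟩
  · have h1 := cost_diff (piv := piv) (Sg := Sg) hPs hP hXs
    have h2 : cost Pr A B Q R piv Sg K - cost Pr A B Q R piv Sg Ks = _ := h1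
    rw [h2, Finset.mul_sum]
    refine Finset.sum_le_sum fun i _ => ?_
    rw [completion_of_squares (hΨ i) (hEs i) (K i) (Ks i)]
    have hLK : (R i + (B i)ᵀ * opE Pr (PK Pr A B Q R K) i * B i) * K i
        - (B i)ᵀ * opE Pr (PK Pr A B Q R K) i * A i = LK Pr A B Q R K i := rfl
    rw [hLK, Matrix.sub_mul, Matrix.trace_sub]
    have h3 := trace_mul_psd_nonneg (psd_conj (hΨ i).posSemidef
      (K i - Ks i - (R i + (B i)ᵀ * opE Pr (PK Pr A B Q R K) i * B i)⁻¹ * LK Pr A B Q R K i))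
      (hXspsd i)
    have h4 := trace_mul_psd_nonneg
      (psd_conj (hΨ i).inv.posSemidef (LK Pr A B Q R K i)) (hcpsd i)
    rw [Matrix.mul_sub, Matrix.trace_sub, Matrix.mul_smul, Matrix.mul_one, Matrix.trace_smul,
      smul_eq_mul] at h4
    linarith
  · rw [div_mul_eq_mul_div, mul_div_assoc]
    refine mul_le_mul_of_nonneg_left ?_ hc
    rw [div_eq_inv_mul, norm2sq, Finset.mul_sum]
    exact Finset.sum_le_sum fun i _ => trace_inv_le (hΨ i) hlam (hΨlam i) _
  · have hGeq : G = fun i => (2 : ℝ) • (LK Pr A B Q R K i * XK Pr piv Sg (Gam A B K) i) := by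
      refine ip_ext fun E => ?_
      rw [← hG E, fderiv_cost Q R piv Sg hdet hX E]
      exact quotFun_zero (fun i => by simpa using (hR i).1.eq) hEs
        (fun i => by simpa using (hXpsd i).1.eq)
    have hXmu : ∀ i, (XK Pr piv Sg (Gam A B K) i
        - mu piv Sg • (1 : Matrix (Fin d) (Fin d) ℝ)).PosSemidef := fun i => by
      have h1 := (hSgmu i).add (opT_psd hPr (Gam A B K) hXpsd i)
      rw [sub_add_eq_add_sub] at h1
      rw [congrFun hX i]
      exact h1
    have hnorm : 4 * mu piv Sg ^ 2 * norm2sq (LK Pr A B Q R K) ≤ norm2sq G := by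
      rw [hGeq, norm2sq, norm2sq, Finset.mul_sum]
      refine Finset.sum_le_sum fun i _ => ?_
      have h1 := trace_mul_sq_ge hmu.le (hXmu i) (LK Pr A B Q R K i)
      rw [Matrix.transpose_smul, Matrix.smul_mul, Matrix.mul_smul, Matrix.trace_smul,
        Matrix.trace_smul, smul_eq_mul, smul_eq_mul]
      linarith
    have h4 : 0 < 4 * mu piv Sg ^ 2 := by positivity
    rw [div_mul_eq_mul_div, div_mul_eq_mul_div, div_le_div_iff₀ hlam (mul_pos h4 hlam)]
    have := mul_le_mul_of_nonneg_left hnorm (mul_nonneg hc hlam.le)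
    linarith

end MJLS
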